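/- Let K be a field of characteristic 0. Then there exist homogeneous elements g1 ∈ [𝔭_K(5,11,18)^{(7)}]_{220} and g2 ∈ [𝔭_K(5,11,18)^{(4)}]_{126} forming an S-regular sequence (note (220/7)·(126/4) = 5·11·18); consequently the symbolic Rees algebra R_s(𝔭_K(5,11,18)) is Noetherian. -/

import Mathlib

open MvPolynomial

noncomputable section

/-- The weight function assigning degrees `a, b, c` to the variables `x, y, z`. -/
def wt (a b c : ℕ) : Fin 3 → ℕ := ![a, b, c]

/-- The `K`-algebra map `K[x,y,z] → K[T]`, `x ↦ T^a`, `y ↦ T^b`, `z ↦ T^c`. -/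
def toPoly (K : Type*) [CommRing K] (a b c : ℕ) :
    MvPolynomial (Fin 3) K →ₐ[K] Polynomial K :=
  aeval ![Polynomial.X ^ a, Polynomial.X ^ b, Polynomial.X ^ c]

/-- The space monomial prime `𝔭_K(a,b,c)`. -/
def pIdeal (K : Type*) [CommRing K] (a b c : ℕ) : Ideal (MvPolynomial (Fin 3) K) :=
  RingHom.ker (toPoly K a b c)

instance pIdeal_isPrime (K : Type*) [Field K] (a b c : ℕ) : (pIdeal K a b c).IsPrime :=
  RingHom.ker_isPrime _

/-- The `n`-th symbolic power `Q^{(n)} = Q^n A_Q ∩ A` of a prime ideal. -/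
def symbPow {A : Type*} [CommRing A] (Q : Ideal A) [Q.IsPrime] (n : ℕ) : Ideal A :=
  Ideal.comap (algebraMap A (Localization.AtPrime Q))
    (Ideal.map (algebraMap A (Localization.AtPrime Q)) (Q ^ n))

/-- The symbolic Rees algebra `A[Qt, Q^{(2)}t^2, …] ⊆ A[t]`. -/
def symbolicRees {A : Type*} [CommRing A] (Q : Ideal A) [Q.IsPrime] :
    Subalgebra A (Polynomial A) :=
  Algebra.adjoin A
    (⋃ n : ℕ, (fun p => Polynomial.C p * Polynomial.X ^ n) '' ((symbPow Q n : Ideal A) : Set A))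

/-- The degree-`d` homogeneous component `[J]_d` of an ideal `J ⊆ K[x,y,z]`,
as a `K`-subspace. -/
def gpiece (K : Type*) [CommRing K] (a b c : ℕ) (J : Ideal (MvPolynomial (Fin 3) K))
    (d : ℕ) : Submodule K (MvPolynomial (Fin 3) K) :=
  (Submodule.restrictScalars K J) ⊓ (weightedHomogeneousSubmodule K (wt a b c) d)

end

namespace SpaceMonomial

noncomputable section

/-- The relation `x⁸ - y²z` of degree `40` of the monomial curve `(T⁵, T¹¹, T¹⁸)`. -/
def f₁ {R : Type*} [CommRing R] (x y z : R) : R := x ^ 8 - y ^ 2 * z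

/-- The relation `y³ - x³z` of degree `33` of the monomial curve `(T⁵, T¹¹, T¹⁸)`. -/
def f₂ {R : Type*} [CommRing R] (x y z : R) : R := y ^ 3 - x ^ 3 * z

/-- The relation `z² - x⁵y` of degree `36` of the monomial curve `(T⁵, T¹¹, T¹⁸)`. -/
def f₃ {R : Type*} [CommRing R] (x y z : R) : R := z ^ 2 - x ^ 5 * y

/-- The element of degree `220` in the seventh symbolic power. -/
def g₁ {R : Type*} [CommRing R] (x y z : R) : R :=
    x ^ 0 * y ^ 2 * z ^ 11 - x ^ 44 * y ^ 0 * z ^ 0 + 11 * x ^ 36 * y ^ 2 * z ^ 1 - 4 * x ^ 33 * y ^ 5 * z ^ 0 -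
    4 * x ^ 31 * y ^ 1 * z ^ 3 - 43 * x ^ 28 * y ^ 4 * z ^ 2 - x ^ 26 * y ^ 0 * z ^ 5 + 32 * x ^ 25 * y ^ 7 * z ^ 1 +
    37 * x ^ 23 * y ^ 3 * z ^ 4 - 6 * x ^ 22 * y ^ 10 * z ^ 0 + 43 * x ^ 20 * y ^ 6 * z ^ 3 -
    2 * x ^ 18 * y ^ 2 * z ^ 6 - 66 * x ^ 17 * y ^ 9 * z ^ 2 - 98 * x ^ 15 * y ^ 5 * z ^ 5 +
    25 * x ^ 14 * y ^ 12 * z ^ 1 - 3 * x ^ 13 * y ^ 1 * z ^ 8 + 94 * x ^ 12 * y ^ 8 * z ^ 4 -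
    3 * x ^ 11 * y ^ 15 * z ^ 0 + 48 * x ^ 10 * y ^ 4 * z ^ 7 - 40 * x ^ 9 * y ^ 11 * z ^ 3 + x ^ 8 * y ^ 0 * z ^ 10 -
    26 * x ^ 7 * y ^ 7 * z ^ 6 + 16 * x ^ 6 * y ^ 14 * z ^ 2 - 12 * x ^ 5 * y ^ 3 * z ^ 9 + x ^ 4 * y ^ 10 * z ^ 5 -
    6 * x ^ 3 * y ^ 17 * z ^ 1 + 4 * x ^ 2 * y ^ 6 * z ^ 8 + x ^ 1 * y ^ 13 * z ^ 4 + x ^ 0 * y ^ 20 * z ^ 0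

/-- The element of degree `126` in the fourth symbolic power. -/
def g₂ {R : Type*} [CommRing R] (x y z : R) : R :=
    x ^ 23 * y ^ 1 * z ^ 0 - 2 * x ^ 18 * y ^ 0 * z ^ 2 - 3 * x ^ 15 * y ^ 3 * z ^ 1 + x ^ 12 * y ^ 6 * z ^ 0 +
    11 * x ^ 10 * y ^ 2 * z ^ 3 - 8 * x ^ 7 * y ^ 5 * z ^ 2 - 5 * x ^ 5 * y ^ 1 * z ^ 5 + 4 * x ^ 4 * y ^ 8 * z ^ 1 +
    x ^ 2 * y ^ 4 * z ^ 4 - x ^ 1 * y ^ 11 * z ^ 0 + x ^ 0 * y ^ 0 * z ^ 7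

section Certificates

variable {R : Type*} [CommRing R] {I : Ideal R} {x y z : R}

theorem mul_mem_pow_of_mem {u v w : R} (hu : u ∈ I) (hv : v ∈ I) (hw : w ∈ I)
    (i j k : ℕ) (c : R) {n : ℕ} (hn : i + j + k = n) : u ^ i * v ^ j * w ^ k * c ∈ I ^ n := by
  rw [← hn, pow_add, pow_add]
  exact Ideal.mul_mem_right _ _ (Ideal.mul_mem_mul (Ideal.mul_mem_mul
    (Ideal.pow_mem_pow hu _) (Ideal.pow_mem_pow hv _)) (Ideal.pow_mem_pow hw _))

theorem pow_mul_g₁_mem (h₁ : f₁ x y z ∈ I) (h₂ : f₂ x y z ∈ I) (h₃ : f₃ x y z ∈ I) :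
    x ^ 12 * g₁ x y z ∈ I ^ 7 := by
  have h : x ^ 12 * g₁ x y z =
      f₁ x y z ^ 7 * f₂ x y z ^ 0 * f₃ x y z ^ 0 * (-1) +
      f₁ x y z ^ 5 * f₂ x y z ^ 1 * f₃ x y z ^ 1 * (5 * y) +
      f₁ x y z ^ 4 * f₂ x y z ^ 3 * f₃ x y z ^ 0 * (x ^ 2 * y) +
      f₁ x y z ^ 4 * f₂ x y z ^ 1 * f₃ x y z ^ 2 * (x ^ 3) +
      f₁ x y z ^ 3 * f₂ x y z ^ 2 * f₃ x y z ^ 2 * (-7 * y ^ 2) +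
      f₁ x y z ^ 3 * f₂ x y z ^ 0 * f₃ x y z ^ 4 * (x * y) +
      f₁ x y z ^ 2 * f₂ x y z ^ 4 * f₃ x y z ^ 1 * (-2 * x ^ 2 * y ^ 2) +
      f₁ x y z ^ 2 * f₂ x y z ^ 2 * f₃ x y z ^ 3 * (x ^ 3 * y) +
      f₁ x y z ^ 2 * f₂ x y z ^ 0 * f₃ x y z ^ 5 * (x ^ 4) +
      f₁ x y z ^ 1 * f₂ x y z ^ 3 * f₃ x y z ^ 3 * (3 * y ^ 3) +
      f₁ x y z ^ 1 * f₂ x y z ^ 1 * f₃ x y z ^ 5 * (-x * y ^ 2) +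
      f₁ x y z ^ 0 * f₂ x y z ^ 5 * f₃ x y z ^ 2 * (x ^ 2 * y ^ 3) +
      f₁ x y z ^ 0 * f₂ x y z ^ 3 * f₃ x y z ^ 4 * (-2 * x ^ 3 * y ^ 2) := by
    simp only [g₁, f₁, f₂, f₃]
    ring
  rw [h]
  repeat' first
    | refine Ideal.add_mem _ ?_ ?_
    | exact mul_mem_pow_of_mem h₁ h₂ h₃ _ _ _ _ (by norm_num)

theorem pow_mul_g₂_mem (h₁ : f₁ x y z ∈ I) (h₂ : f₂ x y z ∈ I) (h₃ : f₃ x y z ∈ I) :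
    x ^ 6 * g₂ x y z ∈ I ^ 4 := by
  have h : x ^ 6 * g₂ x y z =
      f₁ x y z ^ 3 * f₂ x y z ^ 0 * f₃ x y z ^ 1 * (-1) +
      f₁ x y z ^ 2 * f₂ x y z ^ 2 * f₃ x y z ^ 0 * (-x ^ 2) +
      f₁ x y z ^ 1 * f₂ x y z ^ 1 * f₃ x y z ^ 2 * (y) +
      f₁ x y z ^ 0 * f₂ x y z ^ 3 * f₃ x y z ^ 1 * (x ^ 2 * y) +
      f₁ x y z ^ 0 * f₂ x y z ^ 1 * f₃ x y z ^ 3 * (-x ^ 3) := by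
    simp only [g₂, f₁, f₂, f₃]
    ring
  rw [h]
  repeat' first
    | refine Ideal.add_mem _ ?_ ?_
    | exact mul_mem_pow_of_mem h₁ h₂ h₃ _ _ _ _ (by norm_num)

theorem f₁_pow_eq (h₁ : f₁ x y z ∈ I) (h₂ : f₂ x y z ∈ I) (h₃ : f₃ x y z ∈ I) :
    ∃ a ∈ I ^ 3, ∃ b ∈ I ^ 6, f₁ x y z ^ 10 = g₁ x y z * a + g₂ x y z * b := by
  refine ⟨f₁ x y z ^ 3 * f₂ x y z ^ 0 * f₃ x y z ^ 0 * (-x ^ 12 - 5 * x ^ 4 * y ^ 2 * z + 10 * x * y ^ 5) +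
      f₁ x y z ^ 2 * f₂ x y z ^ 0 * f₃ x y z ^ 1 * (-6 * x ^ 7 * y * z) +
      f₁ x y z ^ 1 * f₂ x y z ^ 1 * f₃ x y z ^ 1 * (-11 * x * y ^ 6) +
      f₁ x y z ^ 1 * f₂ x y z ^ 0 * f₃ x y z ^ 2 * (x ^ 10 * z - 31 * x ^ 7 * y ^ 3) +
      f₁ x y z ^ 0 * f₂ x y z ^ 3 * f₃ x y z ^ 0 * (-3 * x ^ 3 * y ^ 6) +
      f₁ x y z ^ 0 * f₂ x y z ^ 1 * f₃ x y z ^ 2 * (14 * x ^ 4 * y ^ 5) +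
      f₁ x y z ^ 0 * f₂ x y z ^ 0 * f₃ x y z ^ 3 * (11 * x ^ 10 * y ^ 2), ?_,
      f₁ x y z ^ 6 * f₂ x y z ^ 0 * f₃ x y z ^ 0 * (6 * x * y * z) +
      f₁ x y z ^ 5 * f₂ x y z ^ 0 * f₃ x y z ^ 1 * (48 * x * y ^ 3) +
      f₁ x y z ^ 4 * f₂ x y z ^ 2 * f₃ x y z ^ 0 * (-5 * x ^ 3 * y ^ 3) +
      f₁ x y z ^ 4 * f₂ x y z ^ 0 * f₃ x y z ^ 2 * (15 * x ^ 4 * y ^ 2) +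
      f₁ x y z ^ 3 * f₂ x y z ^ 3 * f₃ x y z ^ 0 * (13 * y ^ 5) +
      f₁ x y z ^ 3 * f₂ x y z ^ 1 * f₃ x y z ^ 2 * (-88 * x * y ^ 4) +
      f₁ x y z ^ 3 * f₂ x y z ^ 0 * f₃ x y z ^ 3 * (-11 * x ^ 7 * y + 13 * x ^ 2 * z ^ 2) +
      f₁ x y z ^ 2 * f₂ x y z ^ 3 * f₃ x y z ^ 1 * (5 * x ^ 3 * y ^ 4) +
      f₁ x y z ^ 2 * f₂ x y z ^ 1 * f₃ x y z ^ 3 * (-7 * x ^ 4 * y ^ 3) +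
      f₁ x y z ^ 2 * f₂ x y z ^ 0 * f₃ x y z ^ 4 * (-14 * x ^ 10) +
      f₁ x y z ^ 1 * f₂ x y z ^ 4 * f₃ x y z ^ 1 * (-14 * y ^ 6) +
      f₁ x y z ^ 1 * f₂ x y z ^ 2 * f₃ x y z ^ 3 * (47 * x * y ^ 5) +
      f₁ x y z ^ 1 * f₂ x y z ^ 0 * f₃ x y z ^ 5 * (-13 * x ^ 2 * y ^ 4) +
      f₁ x y z ^ 0 * f₂ x y z ^ 6 * f₃ x y z ^ 0 * (-3 * x ^ 2 * y ^ 6) +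
      f₁ x y z ^ 0 * f₂ x y z ^ 4 * f₃ x y z ^ 2 * (17 * x ^ 3 * y ^ 5) +
      f₁ x y z ^ 0 * f₂ x y z ^ 2 * f₃ x y z ^ 4 * (-22 * x ^ 4 * y ^ 4), ?_, ?_⟩
  iterate 2
    repeat' first
      | refine Ideal.add_mem _ ?_ ?_
      | exact mul_mem_pow_of_mem h₁ h₂ h₃ _ _ _ _ (by norm_num)
  simp only [g₁, g₂, f₁, f₂, f₃]
  ring

theorem pow_mul_f₂_pow_eq (h₁ : f₁ x y z ∈ I) (h₂ : f₂ x y z ∈ I) (h₃ : f₃ x y z ∈ I) :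
    ∃ a ∈ I ^ 2, ∃ b ∈ I ^ 5, x ^ 5 * f₂ x y z ^ 9 = g₁ x y z * a + g₂ x y z * b := by
  refine ⟨x ^ 5 * (f₁ x y z ^ 0 * f₂ x y z ^ 2 * f₃ x y z ^ 0 * (y) +
      f₁ x y z ^ 0 * f₂ x y z ^ 0 * f₃ x y z ^ 2 * (-2 * x)),
      Ideal.mul_mem_left _ _ ?_,
      f₁ x y z ^ 4 * f₂ x y z ^ 0 * f₃ x y z ^ 1 * (2) +
      f₁ x y z ^ 3 * f₂ x y z ^ 2 * f₃ x y z ^ 0 * (-x ^ 2) +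
      f₁ x y z ^ 2 * f₂ x y z ^ 1 * f₃ x y z ^ 2 * (-6 * y) +
      f₁ x y z ^ 1 * f₂ x y z ^ 3 * f₃ x y z ^ 1 * (x ^ 2 * y) +
      f₁ x y z ^ 1 * f₂ x y z ^ 1 * f₃ x y z ^ 3 * (-2 * x ^ 3) +
      f₁ x y z ^ 0 * f₂ x y z ^ 2 * f₃ x y z ^ 3 * (4 * y ^ 2), ?_, ?_⟩
  iterate 2
    repeat' first
      | refine Ideal.add_mem _ ?_ ?_
      | exact mul_mem_pow_of_mem h₁ h₂ h₃ _ _ _ _ (by norm_num)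
  simp only [g₁, g₂, f₁, f₂, f₃]
  ring

theorem map_g₁ {S : Type*} [CommRing S] (φ : R →+* S) (x y z : R) :
    φ (g₁ x y z) = g₁ (φ x) (φ y) (φ z) := by
  simp only [g₁, map_add, map_sub, map_mul, map_pow, map_ofNat]

theorem map_g₂ {S : Type*} [CommRing S] (φ : R →+* S) (x y z : R) :
    φ (g₂ x y z) = g₂ (φ x) (φ y) (φ z) := by
  simp only [g₂, map_add, map_sub, map_mul, map_pow, map_ofNat]

theorem g₁_scale (t : R) :
    g₁ (x * t ^ 5) (y * t ^ 11) (z * t ^ 18) = g₁ x y z * t ^ 220 := by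
  simp only [g₁]
  ring

theorem g₂_scale (t : R) :
    g₂ (x * t ^ 5) (y * t ^ 11) (z * t ^ 18) = g₂ x y z * t ^ 126 := by
  simp only [g₂]
  ring

end Certificates

section Homogeneous

variable {R : Type*} [CommRing R] {x y z : R}

theorem ofNat_mul_mem (N : AddSubgroup R) (c : ℕ) [c.AtLeastTwo] {u v w : R}
    (h : u * v * w ∈ N) : ofNat(c) * u * v * w ∈ N := by
  rw [← Nat.cast_ofNat (R := R), mul_assoc, mul_assoc, ← nsmul_eq_mul, ← mul_assoc]
  exact N.nsmul_mem h _

theorem g₁_mem_of_forall (N : AddSubgroup R)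
    (h : ∀ a b e : ℕ, 5 * a + 11 * b + 18 * e = 220 → x ^ a * y ^ b * z ^ e ∈ N) :
    g₁ x y z ∈ N := by
  unfold g₁
  repeat' first
    | with_reducible refine add_mem ?_ ?_
    | with_reducible refine sub_mem ?_ ?_
    | with_reducible refine h _ _ _ ?_
    | with_reducible refine ofNat_mul_mem N _ ?_
  all_goals rfl

theorem g₂_mem_of_forall (N : AddSubgroup R)
    (h : ∀ a b e : ℕ, 5 * a + 11 * b + 18 * e = 126 → x ^ a * y ^ b * z ^ e ∈ N) :
    g₂ x y z ∈ N := by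
  unfold g₂
  repeat' first
    | with_reducible refine add_mem ?_ ?_
    | with_reducible refine sub_mem ?_ ?_
    | with_reducible refine h _ _ _ ?_
    | with_reducible refine ofNat_mul_mem N _ ?_
  all_goals rfl

end Homogeneous

section WeightedPow

variable {R : Type*} [CommRing R] {a b r : R}

/-- The ideal generated by the monomials `a ^ i * b ^ j` with `n ≤ 7 * i + 4 * j`. -/
def weightedPow (a b : R) (n : ℕ) : Ideal R :=
  Ideal.span {h | ∃ i j : ℕ, n ≤ 7 * i + 4 * j ∧ a ^ i * b ^ j = h}

theorem mul_pow_mem_weightedPow {n i j : ℕ} (h : n ≤ 7 * i + 4 * j) :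
    a ^ i * b ^ j ∈ weightedPow a b n :=
  Ideal.subset_span ⟨i, j, h, rfl⟩

theorem weightedPow_zero (a b : R) : weightedPow a b 0 = ⊤ := by
  rw [Ideal.eq_top_iff_one]
  simpa using mul_pow_mem_weightedPow (a := a) (b := b) (n := 0) (i := 0) (j := 0) le_rfl

theorem weightedPow_antitone (a b : R) : Antitone (weightedPow a b) := fun _ _ h =>
  Ideal.span_mono fun _ ⟨i, j, hij, e⟩ => ⟨i, j, h.trans hij, e⟩

theorem map_weightedPow {S : Type*} [CommRing S] (φ : R →+* S) (a b : R) (n : ℕ) :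
    (weightedPow a b n).map φ = weightedPow (φ a) (φ b) n := by
  rw [weightedPow, Ideal.map_span, weightedPow]
  congr 1
  ext h
  constructor
  · rintro ⟨_, ⟨i, j, hij, rfl⟩, rfl⟩
    exact ⟨i, j, hij, by simp⟩
  · rintro ⟨i, j, hij, rfl⟩
    exact ⟨_, ⟨i, j, hij, rfl⟩, by simp⟩

theorem span_mul_weightedPow_le (a b : R) (n : ℕ) :
    Ideal.span {a} * weightedPow a b n ≤ weightedPow a b (n + 7) := by
  rw [weightedPow, Ideal.span_mul_span', Ideal.span_le]
  rintro _ ⟨_, rfl, _, ⟨i, j, hij, rfl⟩, rfl⟩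
  exact Ideal.subset_span ⟨i + 1, j, by lia, by ring⟩

theorem span_mul_weightedPow_le' (a b : R) (n : ℕ) :
    Ideal.span {b} * weightedPow a b n ≤ weightedPow a b (n + 4) := by
  rw [weightedPow, Ideal.span_mul_span', Ideal.span_le]
  rintro _ ⟨_, rfl, _, ⟨i, j, hij, rfl⟩, rfl⟩
  exact Ideal.subset_span ⟨i, j + 1, by lia, by ring⟩

theorem exists_eq_of_mem_weightedPow {n : ℕ} {h : R} (hh : h ∈ weightedPow a b n) :
    ∃ u ∈ weightedPow a b (n - 7), ∃ c, h = a * u + b ^ ((n + 3) / 4) * c := by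
  induction hh using Submodule.span_induction with
  | mem h hh =>
    obtain ⟨i, j, hij, rfl⟩ := hh
    rcases i with _ | i
    · refine ⟨0, zero_mem _, b ^ (j - (n + 3) / 4), ?_⟩
      rw [← pow_add, Nat.add_sub_cancel' (by lia)]
      simp
    · exact ⟨a ^ i * b ^ j, mul_pow_mem_weightedPow (by lia), 0, by ring⟩
  | zero => exact ⟨0, zero_mem _, 0, by simp⟩
  | add h h' _ _ ih ih' =>
    obtain ⟨u, hu, c, rfl⟩ := ih
    obtain ⟨u', hu', c', rfl⟩ := ih'
    exact ⟨u + u', add_mem hu hu', c + c', by ring⟩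
  | smul s h _ ih =>
    obtain ⟨u, hu, c, rfl⟩ := ih
    exact ⟨s * u, Ideal.mul_mem_left _ s hu, s * c, by rw [smul_eq_mul]; ring⟩

theorem dvd_of_dvd_pow_mul (hab : ∀ f, a ∣ b * f → a ∣ f) (k : ℕ) {f : R}
    (h : a ∣ b ^ k * f) : a ∣ f := by
  induction k with
  | zero => simpa using h
  | succ k ih => exact ih (hab _ (by rwa [pow_succ', mul_assoc] at h))

theorem exists_eq_of_mul_eq_add_pow_mul [IsDomain R] (hab : ∀ f, a ∣ b * f → a ∣ f)
    (hr : ∀ h, r * h ∈ Ideal.span {a, b} → h ∈ Ideal.span {a, b}) (k : ℕ) {h u c : R}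
    (e : r * h = a * u + b ^ k * c) : ∃ u' c', h = a * u' + b ^ k * c' := by
  induction k generalizing h u c with
  | zero => exact ⟨0, h, by simp⟩
  | succ k ih =>
    obtain ⟨u', h', rfl⟩ := Ideal.mem_span_pair.1 (hr h (Ideal.mem_span_pair.2
      ⟨u, b ^ k * c, by rw [e]; ring⟩))
    obtain ⟨w, hw⟩ := hab (r * h' - b ^ k * c) ⟨u - r * u', by linear_combination e⟩
    obtain ⟨u₂, c₂, rfl⟩ := ih (h := h') (u := w) (c := c) (by linear_combination hw)
    exact ⟨u' + b * u₂, c₂, by ring⟩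

/-- If `a, b` is a regular sequence and `r` is regular modulo `(a, b)`, then `r` is regular
modulo each `weightedPow a b n`. -/
theorem mem_weightedPow_of_mul_mem [IsDomain R] (ha : a ≠ 0) (hab : ∀ f, a ∣ b * f → a ∣ f)
    (hr : ∀ h, r * h ∈ Ideal.span {a, b} → h ∈ Ideal.span {a, b}) (n : ℕ) {h : R}
    (hh : r * h ∈ weightedPow a b n) : h ∈ weightedPow a b n := by
  induction n using Nat.strong_induction_on generalizing h with
  | _ n ih =>
    rcases Nat.eq_zero_or_pos n with rfl | hn
    · simp [weightedPow_zero]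
    obtain ⟨u, hu, c, e⟩ := exists_eq_of_mem_weightedPow hh
    obtain ⟨h', d, rfl⟩ := exists_eq_of_mul_eq_add_pow_mul hab hr _ e
    set k := (n + 3) / 4 with hk
    have hbk : ∀ m ≤ n, b ^ k ∈ weightedPow a b m := fun m hm => by
      simpa using mul_pow_mem_weightedPow (a := a) (b := b) (n := m) (i := 0) (j := k) (by lia)
    obtain ⟨w, hw⟩ := dvd_of_dvd_pow_mul hab k (f := c - r * d)
      ⟨r * h' - u, by linear_combination -e⟩
    have e' : r * h' = u + b ^ k * w :=
      mul_left_cancel₀ ha (by linear_combination e + b ^ k * hw)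
    have hh' : h' ∈ weightedPow a b (n - 7) := ih _ (by lia) (by
      rw [e']
      exact add_mem hu (Ideal.mul_mem_right _ _ (hbk _ (Nat.sub_le _ _))))
    refine add_mem (weightedPow_antitone a b (by lia : n ≤ n - 7 + 7) ?_)
      (Ideal.mul_mem_right _ _ (hbk n le_rfl))
    exact span_mul_weightedPow_le a b _ (Ideal.mul_mem_mul (Ideal.mem_span_singleton_self a) hh')

theorem sup_pow_le_mul_sup_mul (I J : Ideal R) {n : ℕ} (hn : 18 ≤ n) :
    (I ⊔ J) ^ n ≤ I ^ 10 * (I ⊔ J) ^ (n - 10) ⊔ J ^ 9 * (I ⊔ J) ^ (n - 9) := by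
  conv_lhs => rw [← Ideal.add_eq_sup, add_pow]
  rw [Ideal.sum_eq_sup]
  refine Finset.sup_le fun i hi => Ideal.mul_le_left.trans ?_
  have hi : i ≤ n := by simpa [Nat.lt_succ_iff] using hi
  by_cases h : 10 ≤ i
  · refine le_trans (le_of_eq ?_) ((Ideal.mul_mono_right
      (?_ : I ^ (i - 10) * J ^ (n - i) ≤ (I ⊔ J) ^ (n - 10))).trans le_sup_left)
    · rw [← mul_assoc, ← pow_add, Nat.add_sub_cancel' h]
    · rw [(by lia : n - 10 = (i - 10) + (n - i)), pow_add]
      exact Ideal.mul_mono (Ideal.pow_right_mono le_sup_left _)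
        (Ideal.pow_right_mono le_sup_right _)
  · refine le_trans (le_of_eq ?_) ((Ideal.mul_mono_right
      (?_ : I ^ i * J ^ (n - i - 9) ≤ (I ⊔ J) ^ (n - 9))).trans le_sup_right)
    · rw [mul_left_comm, ← pow_add, Nat.add_sub_cancel' (by lia)]
    · rw [(by lia : n - 9 = i + (n - i - 9)), pow_add]
      exact Ideal.mul_mono (Ideal.pow_right_mono le_sup_left _)
        (Ideal.pow_right_mono le_sup_right _)

variable {x y z : R}

theorem f₃_mem (hx : IsUnit x) : f₃ x y z ∈ Ideal.span {f₁ x y z, f₂ x y z} := by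
  obtain ⟨u, rfl⟩ := hx
  rw [← Ideal.unit_mul_mem_iff_mem _ (u.isUnit.pow 3), Ideal.mem_span_pair]
  exact ⟨-y, -z, by simp only [f₁, f₂, f₃]; ring⟩

theorem span_pow_le_weightedPow (hx : IsUnit x) (n : ℕ) :
    Ideal.span {f₁ x y z, f₂ x y z} ^ n ≤ weightedPow (g₁ x y z) (g₂ x y z) (n - 17) := by
  set Q := Ideal.span {f₁ x y z, f₂ x y z} with hQ
  have h₁ : f₁ x y z ∈ Q := Ideal.subset_span (by simp)
  have h₂ : f₂ x y z ∈ Q := Ideal.subset_span (by simp)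
  have h₃ : f₃ x y z ∈ Q := f₃_mem hx
  have hsup : Q = Ideal.span {f₁ x y z} ⊔ Ideal.span {f₂ x y z} := Ideal.span_insert _ _
  have key₁ : Ideal.span {f₁ x y z} ^ 10 ≤
      Ideal.span {g₁ x y z} * Q ^ 3 ⊔ Ideal.span {g₂ x y z} * Q ^ 6 := by
    obtain ⟨a, ha, b, hb, e⟩ := f₁_pow_eq h₁ h₂ h₃
    rw [Ideal.span_singleton_pow, Ideal.span_singleton_le_iff_mem, e]
    exact Ideal.add_mem _
      (Ideal.mem_sup_left (Ideal.mul_mem_mul (Ideal.mem_span_singleton_self _) ha))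
      (Ideal.mem_sup_right (Ideal.mul_mem_mul (Ideal.mem_span_singleton_self _) hb))
  have key₂ : Ideal.span {f₂ x y z} ^ 9 ≤
      Ideal.span {g₁ x y z} * Q ^ 2 ⊔ Ideal.span {g₂ x y z} * Q ^ 5 := by
    obtain ⟨a, ha, b, hb, e⟩ := pow_mul_f₂_pow_eq h₁ h₂ h₃
    rw [Ideal.span_singleton_pow, Ideal.span_singleton_le_iff_mem,
      ← Ideal.unit_mul_mem_iff_mem _ (hx.pow 5), e]
    exact Ideal.add_mem _
      (Ideal.mem_sup_left (Ideal.mul_mem_mul (Ideal.mem_span_singleton_self _) ha))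
      (Ideal.mem_sup_right (Ideal.mul_mem_mul (Ideal.mem_span_singleton_self _) hb))
  induction n using Nat.strong_induction_on with
  | _ n ih =>
    rcases lt_or_ge n 18 with hn | hn
    · rw [(by lia : n - 17 = 0), weightedPow_zero]
      exact le_top
    have step : Q ^ n ≤
        Ideal.span {g₁ x y z} * Q ^ (n - 7) ⊔ Ideal.span {g₂ x y z} * Q ^ (n - 4) := by
      have h := sup_pow_le_mul_sup_mul (Ideal.span {f₁ x y z}) (Ideal.span {f₂ x y z}) hn
      rw [← hsup] at h
      refine h.trans (sup_le ?_ ?_)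
      · refine (Ideal.mul_mono_left key₁).trans (le_of_eq ?_)
        rw [Ideal.sup_mul, mul_assoc, mul_assoc, ← pow_add, ← pow_add,
          (by lia : 3 + (n - 10) = n - 7), (by lia : 6 + (n - 10) = n - 4)]
      · refine (Ideal.mul_mono_left key₂).trans (le_of_eq ?_)
        rw [Ideal.sup_mul, mul_assoc, mul_assoc, ← pow_add, ← pow_add,
          (by lia : 2 + (n - 9) = n - 7), (by lia : 5 + (n - 9) = n - 4)]
    refine step.trans (sup_le ?_ ?_)
    · exact (Ideal.mul_mono_right (ih (n - 7) (by lia))).trans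
        ((span_mul_weightedPow_le _ _ _).trans (weightedPow_antitone _ _ (by lia)))
    · exact (Ideal.mul_mono_right (ih (n - 4) (by lia))).trans
        ((span_mul_weightedPow_le' _ _ _).trans (weightedPow_antitone _ _ (by lia)))

theorem mem_span_X_pow_of_coeff_mem (d : ℕ) (A : Subalgebra R (Polynomial R))
    (ha : Polynomial.C a * Polynomial.X ^ 7 ∈ A) (hb : Polynomial.C b * Polynomial.X ^ 4 ∈ A)
    {f : Polynomial R} (hf : ∀ n, f.coeff n ∈ weightedPow a b (n - d)) :
    f ∈ Submodule.span A ((fun e => (Polynomial.X : Polynomial R) ^ e) '' Set.Iic (d + 7)) := by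
  set W := Submodule.span A ((fun e => (Polynomial.X : Polynomial R) ^ e) '' Set.Iic (d + 7))
  have hX : ∀ e ≤ d + 7, (Polynomial.X : Polynomial R) ^ e ∈ W := fun e he =>
    Submodule.subset_span (Set.mem_image_of_mem _ he)
  have hC : ∀ (c : R) (f : Polynomial R), f ∈ W → Polynomial.C c * f ∈ W := fun c f hf => by
    simpa [Algebra.smul_def] using W.smul_mem (algebraMap R A c) hf
  have hmon : ∀ m i j n : ℕ, i + j = m → n ≤ 7 * i + 4 * j + (d + 7) →
      Polynomial.C (a ^ i * b ^ j) * Polynomial.X ^ n ∈ W := by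
    intro m
    induction m with
    | zero =>
      intro i j n hm hn
      obtain ⟨rfl, rfl⟩ : i = 0 ∧ j = 0 := by lia
      simpa using hX n (by lia)
    | succ m ih =>
      intro i j n hm hn
      rcases le_or_gt (7 * i + 4 * j) n with h | h
      · have e : Polynomial.C (a ^ i * b ^ j) * Polynomial.X ^ n =
            ((⟨_, ha⟩ : A) ^ i * (⟨_, hb⟩ : A) ^ j) •
              (Polynomial.X : Polynomial R) ^ (n - (7 * i + 4 * j)) := by
          simp only [Subalgebra.smul_def, Subalgebra.coe_mul, Subalgebra.coe_pow, smul_eq_mul,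
            mul_pow, ← pow_mul, Polynomial.C_mul, Polynomial.C_pow]
          conv_lhs => rw [← Nat.add_sub_cancel' h, pow_add, pow_add]
          ring
        rw [e]
        exact W.smul_mem _ (hX _ (by lia))
      · rcases i with _ | i
        · rcases j with _ | j
          · lia
          · have := hC b _ (ih 0 j n (by lia) (by lia))
            rwa [← mul_assoc, ← Polynomial.C_mul, mul_left_comm, ← pow_succ'] at this
        · have := hC a _ (ih i j n (by lia) (by lia))
          rwa [← mul_assoc, ← Polynomial.C_mul, ← mul_assoc, ← pow_succ'] at this
  rw [f.as_sum_range_C_mul_X_pow]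
  refine sum_mem fun n _ => ?_
  have h := hf n
  generalize f.coeff n = c at h
  induction h using Submodule.span_induction with
  | mem c hc =>
    obtain ⟨i, j, hij, rfl⟩ := hc
    exact hmon _ i j n rfl (by lia)
  | zero => simp
  | add c c' _ _ ih ih' =>
    rw [Polynomial.C_add, add_mul]
    exact add_mem ih ih'
  | smul s c _ ih =>
    rw [smul_eq_mul, Polynomial.C_mul, mul_assoc]
    exact hC s _ ih

/-- A subalgebra of `R[t]` that contains `a * t ^ 7` and `b * t ^ 4` and whose elements have
coefficients in the ideals `weightedPow a b (n - d)` is finite over `R[a * t ^ 7, b * t ^ 4]`. -/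
theorem isNoetherianRing_of_coeff_mem_weightedPow [IsNoetherianRing R] (d : ℕ)
    (B : Subalgebra R (Polynomial R))
    (ha : Polynomial.C a * Polynomial.X ^ 7 ∈ B) (hb : Polynomial.C b * Polynomial.X ^ 4 ∈ B)
    (hB : ∀ f ∈ B, ∀ n, f.coeff n ∈ weightedPow a b (n - d)) : IsNoetherianRing B := by
  let A := Algebra.adjoin R
    {Polynomial.C a * Polynomial.X ^ 7, Polynomial.C b * Polynomial.X ^ 4}
  have haA : Polynomial.C a * Polynomial.X ^ 7 ∈ A := Algebra.subset_adjoin (by simp)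
  have hbA : Polynomial.C b * Polynomial.X ^ 4 ∈ A := Algebra.subset_adjoin (by simp)
  have hAB : A ≤ B := Algebra.adjoin_le (by
    rintro _ (rfl | rfl)
    exacts [ha, hb])
  have hfg : A.FG := Subalgebra.fg_def.2 ⟨_, Set.toFinite _, rfl⟩
  have : Algebra.FiniteType R A := A.fg_iff_finiteType.1 hfg
  have : IsNoetherianRing A := Algebra.FiniteType.isNoetherianRing R A
  let W : Submodule A (Polynomial R) :=
    Submodule.span A ((fun e => Polynomial.X ^ e) '' Set.Iic (d + 7))
  have hW : IsNoetherian A W :=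
    isNoetherian_span_of_finite A ((Set.finite_Iic _).image _)
  have hBW : ∀ f ∈ B, f ∈ W := fun f hf => mem_span_X_pow_of_coeff_mem d A haA hbA (hB f hf)
  let : Algebra A B := (Subalgebra.inclusion hAB).toRingHom.toAlgebra
  let ι : B →ₗ[A] W :=
    { toFun := fun f => ⟨f, hBW f f.2⟩
      map_add' := fun _ _ => rfl
      map_smul' := fun _ _ => rfl }
  have hι : Function.Injective ι := fun f g h => Subtype.ext (congrArg (fun w : W => w.1) h)
  have : IsNoetherian A B := isNoetherian_of_injective ι hι
  exact isNoetherian_of_tower A this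

end WeightedPow

section Scaling

variable {K : Type*} [Field K]

/-- The `K`-algebra map `x ↦ x * t ^ 5`, `y ↦ y * t ^ 11`, `z ↦ z * t ^ 18` that records the
grading of `K[x, y, z]`. -/
def scale (K : Type*) [Field K] :
    MvPolynomial (Fin 3) K →ₐ[K] Polynomial (MvPolynomial (Fin 3) K) :=
  aeval ![Polynomial.C (X 0) * Polynomial.X ^ 5, Polynomial.C (X 1) * Polynomial.X ^ 11,
    Polynomial.C (X 2) * Polynomial.X ^ 18]

theorem eval_one_scale (f : MvPolynomial (Fin 3) K) : (scale K f).eval 1 = f := by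
  have h : (Polynomial.evalRingHom 1).comp (scale K).toRingHom =
      RingHom.id (MvPolynomial (Fin 3) K) := by
    refine MvPolynomial.ringHom_ext (fun c => ?_) (fun i => ?_)
    · simp [scale, Polynomial.algebraMap_apply, MvPolynomial.algebraMap_eq]
    · fin_cases i <;> simp [scale]
  exact congrArg (fun φ : MvPolynomial (Fin 3) K →+* _ => φ f) h

theorem coeff_zero_scale (c : K) (r : MvPolynomial (Fin 3) K) :
    (scale K (C c + X 0 * r)).coeff 0 = C c := by
  simp [scale, Polynomial.algebraMap_apply, MvPolynomial.algebraMap_eq, Polynomial.mul_coeff_zero]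

theorem map_scale_eq_zero {G : Set (MvPolynomial (Fin 3) K)}
    (hG : ∀ g ∈ G, ∃ d, scale K g = Polynomial.C g * Polynomial.X ^ d)
    {f : MvPolynomial (Fin 3) K} (hf : f ∈ Ideal.span G) :
    (scale K f).map (Ideal.Quotient.mk (Ideal.span G)) = 0 := by
  have h : Ideal.span G ≤ RingHom.ker
      ((Polynomial.mapRingHom (Ideal.Quotient.mk (Ideal.span G))).comp (scale K).toRingHom) := by
    rw [Ideal.span_le]
    intro g hg
    obtain ⟨d, hd⟩ := hG g hg
    have : Ideal.Quotient.mk (Ideal.span G) g = 0 :=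
      Ideal.Quotient.eq_zero_iff_mem.2 (Ideal.subset_span hg)
    simp [hd, this]
  exact h hf

theorem mk_eq_zero_of_map_scale_eq_zero {J : Ideal (MvPolynomial (Fin 3) K)}
    {f : MvPolynomial (Fin 3) K} (h : (scale K f).map (Ideal.Quotient.mk J) = 0) : f ∈ J := by
  rw [← Ideal.Quotient.eq_zero_iff_mem, ← eval_one_scale f, ← Polynomial.eval_one_map, h,
    Polynomial.eval_zero]

theorem eq_zero_of_mul_eq_zero_of_isUnit_coeff_zero {A : Type*} [CommRing A]
    {p q : Polynomial A} (h : p * q = 0) (hp : IsUnit (p.coeff 0)) : q = 0 :=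
  (mul_left_mem_nonZeroDivisors_eq_zero_iff
    (Polynomial.mem_nonzeroDivisors_of_coeff_mem 0 hp.mem_nonZeroDivisors)).1 h

/-- Modulo a homogeneous ideal, a polynomial of the form `c + x * r` with `c ≠ 0` is regular. -/
theorem mem_span_of_mul_mem {G : Set (MvPolynomial (Fin 3) K)}
    (hG : ∀ g ∈ G, ∃ d, scale K g = Polynomial.C g * Polynomial.X ^ d) {c : K} (hc : c ≠ 0)
    {r f : MvPolynomial (Fin 3) K} (h : (C c + X 0 * r) * f ∈ Ideal.span G) :
    f ∈ Ideal.span G := by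
  have h₁ := map_scale_eq_zero hG h
  rw [map_mul, Polynomial.map_mul] at h₁
  refine mk_eq_zero_of_map_scale_eq_zero (eq_zero_of_mul_eq_zero_of_isUnit_coeff_zero h₁ ?_)
  rw [Polynomial.coeff_map, coeff_zero_scale]
  exact ((isUnit_iff_ne_zero.2 hc).map C).map _

theorem mem_span_of_aeval_mul_mem {G : Set (MvPolynomial (Fin 3) K)}
    (hG : ∀ g ∈ G, ∃ d, scale K g = Polynomial.C g * Polynomial.X ^ d)
    (hX : ∀ f, X 0 * f ∈ Ideal.span G → f ∈ Ideal.span G) {q : Polynomial K} (hq : q ≠ 0)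
    {f : MvPolynomial (Fin 3) K} (h : Polynomial.aeval (X 0) q * f ∈ Ideal.span G) :
    f ∈ Ideal.span G := by
  induction q using Polynomial.recOnHorner with
  | M0 => exact absurd rfl hq
  | MC p a hp ha _ =>
    obtain ⟨p, rfl⟩ := Polynomial.X_dvd_iff.2 hp
    refine mem_span_of_mul_mem hG ha (r := Polynomial.aeval (X 0) p) ?_
    simpa [add_comm, MvPolynomial.algebraMap_eq] using h
  | MX p hp ih =>
    refine ih hp (hX _ ?_)
    simpa [mul_comm, mul_left_comm, mul_assoc] using h

end Scaling

section Regular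

variable (K : Type*) [Field K]

/-- The polynomial `g₁` in `K[x, y, z]`. -/
def polyG₁ : MvPolynomial (Fin 3) K := g₁ (X 0) (X 1) (X 2)

/-- The polynomial `g₂` in `K[x, y, z]`. -/
def polyG₂ : MvPolynomial (Fin 3) K := g₂ (X 0) (X 1) (X 2)

theorem scale_polyG₁ :
    scale K (polyG₁ K) = Polynomial.C (polyG₁ K) * Polynomial.X ^ 220 := by
  rw [polyG₁, map_g₁, ← g₁_scale]
  refine (map_g₁ (scale K).toRingHom (X 0) (X 1) (X 2)).trans ?_
  simp [scale]

theorem scale_polyG₂ :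
    scale K (polyG₂ K) = Polynomial.C (polyG₂ K) * Polynomial.X ^ 126 := by
  rw [polyG₂, map_g₂, ← g₂_scale]
  refine (map_g₂ (scale K).toRingHom (X 0) (X 1) (X 2)).trans ?_
  simp [scale]

theorem exists_scale_eq_of_mem {g : MvPolynomial (Fin 3) K} (hg : g ∈ ({polyG₁ K, polyG₂ K} :
    Set (MvPolynomial (Fin 3) K))) : ∃ d, scale K g = Polynomial.C g * Polynomial.X ^ d := by
  rcases hg with hg | hg
  · exact ⟨220, by rw [hg, scale_polyG₁]⟩
  · exact ⟨126, by rw [Set.mem_singleton_iff.1 hg, scale_polyG₂]⟩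

/-- The substitution `x ↦ 0`. -/
def substZero : MvPolynomial (Fin 3) K →ₐ[K] MvPolynomial (Fin 3) K :=
  aeval ![0, X 1, X 2]

theorem X_dvd_sub_substZero (f : MvPolynomial (Fin 3) K) : X 0 ∣ f - substZero K f := by
  rw [← Ideal.mem_span_singleton, ← Ideal.Quotient.eq]
  have h : Ideal.Quotient.mk (Ideal.span {(X 0 : MvPolynomial (Fin 3) K)}) =
      (Ideal.Quotient.mk _).comp (substZero K).toRingHom := by
    refine MvPolynomial.ringHom_ext (fun c => ?_) (fun i => ?_)
    · simp [substZero, MvPolynomial.algebraMap_eq]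
    · fin_cases i
      · simp [substZero]
      · simp [substZero]
      · simp [substZero]
  exact congrArg (fun φ : MvPolynomial (Fin 3) K →+* _ => φ f) h

theorem substZero_polyG₁ :
    substZero K (polyG₁ K) = X 1 ^ 2 * (X 2 ^ 11 + X 1 ^ 18) := by
  refine (map_g₁ (substZero K).toRingHom (X 0) (X 1) (X 2)).trans ?_
  simp [substZero, g₁]
  ring

theorem substZero_polyG₂ : substZero K (polyG₂ K) = X 2 ^ 7 := by
  refine (map_g₂ (substZero K).toRingHom (X 0) (X 1) (X 2)).trans ?_
  simp [substZero, g₂]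

theorem not_X_dvd_substZero_polyG₁ : ¬ X 2 ∣ substZero K (polyG₁ K) := by
  rintro ⟨w, hw⟩
  have := congrArg (eval ![0, 1, 0]) hw
  simp [substZero_polyG₁] at this

theorem polyG₁_ne_zero : polyG₁ K ≠ 0 := fun h =>
  not_X_dvd_substZero_polyG₁ K (by simp [h])

theorem exists_X_dvd_of_X_dvd {u c : MvPolynomial (Fin 3) K}
    (h : X 0 ∣ polyG₁ K * u + polyG₂ K * c) :
    ∃ e, X 0 ∣ u - polyG₂ K * e ∧ X 0 ∣ c + polyG₁ K * e := by
  obtain ⟨w, hw⟩ := h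
  have hw := congrArg (substZero K) hw
  have h0 : substZero K (X 0) = 0 := by simp [substZero]
  rw [map_add, map_mul, map_mul, map_mul, h0, zero_mul] at hw
  have h2 := substZero_polyG₂ K
  obtain ⟨e, he⟩ := (X_prime (R := K) (i := (2 : Fin 3))).pow_dvd_of_dvd_mul_left 7
    (not_X_dvd_substZero_polyG₁ K) (b := substZero K u)
    ⟨-substZero K c, by linear_combination hw - substZero K c * h2⟩
  have hc : substZero K c = - substZero K (polyG₁ K) * e :=
    mul_left_cancel₀ (pow_ne_zero 7 (X_ne_zero 2)) (by
      linear_combination hw - substZero K c * h2 - substZero K (polyG₁ K) * he)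
  obtain ⟨u', hu⟩ := X_dvd_sub_substZero K u
  obtain ⟨c', hc'⟩ := X_dvd_sub_substZero K c
  obtain ⟨a', ha⟩ := X_dvd_sub_substZero K (polyG₁ K)
  obtain ⟨b', hb⟩ := X_dvd_sub_substZero K (polyG₂ K)
  exact ⟨e, ⟨u' - b' * e, by linear_combination hu - e * hb + he - e * h2⟩,
    ⟨c' + a' * e, by linear_combination hc' + e * ha + hc⟩⟩

theorem mem_span_of_X_mul_mem {h : MvPolynomial (Fin 3) K}
    (hh : X 0 * h ∈ Ideal.span {polyG₁ K, polyG₂ K}) : h ∈ Ideal.span {polyG₁ K, polyG₂ K} := by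
  obtain ⟨u, c, e⟩ := Ideal.mem_span_pair.1 hh
  obtain ⟨w, ⟨u', hu⟩, ⟨c', hc⟩⟩ := exists_X_dvd_of_X_dvd K (u := u) (c := c)
    ⟨h, by linear_combination e⟩
  refine Ideal.mem_span_pair.2 ⟨u', c', mul_left_cancel₀ (X_ne_zero 0) ?_⟩
  linear_combination e - polyG₁ K * hu - polyG₂ K * hc

theorem polyG₁_dvd_of_dvd_mul (f : MvPolynomial (Fin 3) K) (h : polyG₁ K ∣ polyG₂ K * f) :
    polyG₁ K ∣ f := by
  let N : Ideal (MvPolynomial (Fin 3) K) :=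
    Submodule.comap (LinearMap.mulLeft (MvPolynomial (Fin 3) K) (polyG₂ K)) (Ideal.span {polyG₁ K})
  have hN : ∀ f, f ∈ N ↔ polyG₁ K ∣ polyG₂ K * f := fun f => by
    rw [Submodule.mem_comap, LinearMap.mulLeft_apply, Ideal.mem_span_singleton]
  have hle : N ≤ Ideal.span {polyG₁ K} ⊔
      Ideal.span {(X 0 : MvPolynomial (Fin 3) K)} • N := by
    intro f hf
    obtain ⟨w, hw⟩ := (hN f).1 hf
    obtain ⟨e, ⟨w', hw'⟩, ⟨f', hf'⟩⟩ := exists_X_dvd_of_X_dvd K (u := w) (c := -f)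
      ⟨0, by linear_combination -hw⟩
    have hf : f = polyG₁ K * e + X 0 * (-f') := by linear_combination -hf'
    rw [hf]
    refine Submodule.add_mem_sup (Ideal.mem_span_singleton.2 ⟨e, rfl⟩)
      (Submodule.smul_mem_smul (Ideal.mem_span_singleton_self (X 0)) ((hN _).2 ⟨w', ?_⟩))
    refine mul_left_cancel₀ (X_ne_zero (R := K) (0 : Fin 3)) ?_
    linear_combination polyG₁ K * hw' + hw - polyG₂ K * hf
  obtain ⟨r, hr, hrN⟩ := Submodule.exists_sub_one_mem_and_smul_le_of_fg_of_le_sup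
    (IsNoetherian.noetherian N) le_rfl hle
  obtain ⟨s, hs⟩ := Ideal.mem_span_singleton.1 hr
  refine Ideal.mem_span_singleton.1 (mem_span_of_mul_mem (c := 1) (r := s) ?_ one_ne_zero ?_)
  · intro g hg
    exact exists_scale_eq_of_mem K (Or.inl hg)
  · have : C 1 + X 0 * s = r := by rw [← hs, C_1]; ring
    rw [this]
    exact hrN (Submodule.smul_mem_pointwise_smul _ _ _ ((hN f).2 h))

theorem mem_weightedPow_of_aeval_mul_mem {q : Polynomial K} (hq : q ≠ 0) (n : ℕ)
    {h : MvPolynomial (Fin 3) K}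
    (hh : Polynomial.aeval (X 0) q * h ∈ weightedPow (polyG₁ K) (polyG₂ K) n) :
    h ∈ weightedPow (polyG₁ K) (polyG₂ K) n :=
  mem_weightedPow_of_mul_mem (polyG₁_ne_zero K) (polyG₁_dvd_of_dvd_mul K)
    (fun _ => mem_span_of_aeval_mul_mem (fun _ => exists_scale_eq_of_mem K)
      (fun _ => mem_span_of_X_mul_mem K) hq) n hh

end Regular

section SymbolicPowers

variable {A : Type*} [CommRing A] {Q : Ideal A} [Q.IsPrime]

theorem mem_symbPow_of_mul_mem {n : ℕ} {s h : A} (hs : s ∉ Q) (hh : s * h ∈ Q ^ n) :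
    h ∈ symbPow Q n := by
  have hu : IsUnit (algebraMap A (Localization.AtPrime Q) s) :=
    IsLocalization.map_units _ (⟨s, hs⟩ : Q.primeCompl)
  rw [symbPow, Ideal.mem_comap, ← Ideal.unit_mul_mem_iff_mem _ hu, ← map_mul]
  exact Ideal.mem_map_of_mem _ hh

theorem exists_mul_mem_of_mem_map {M : Submonoid A} (L : Type*) [CommRing L] [Algebra A L]
    [IsLocalization M L] {I : Ideal A} {h : A} (hh : algebraMap A L h ∈ I.map (algebraMap A L)) :
    ∃ s ∈ M, s * h ∈ I := by
  obtain ⟨⟨i, s⟩, e⟩ := (IsLocalization.mem_map_algebraMap_iff M L).1 hh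
  rw [← map_mul] at e
  obtain ⟨c, hc⟩ := (IsLocalization.eq_iff_exists M L).1 e
  refine ⟨c * s, mul_mem c.2 s.2, ?_⟩
  rw [mul_assoc, mul_comm (s : A), hc]
  exact I.mul_mem_left _ i.2

theorem exists_mul_mem_of_mem_symbPow {n : ℕ} {h : A} (hh : h ∈ symbPow Q n) :
    ∃ s ∉ Q, s * h ∈ Q ^ n :=
  exists_mul_mem_of_mem_map (M := Q.primeCompl) (Localization.AtPrime Q) hh

theorem mul_mem_symbPow {m n : ℕ} {g h : A} (hg : g ∈ symbPow Q m) (hh : h ∈ symbPow Q n) :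
    g * h ∈ symbPow Q (m + n) := by
  rw [symbPow, Ideal.mem_comap, map_mul, pow_add, Ideal.map_mul]
  exact Ideal.mul_mem_mul hg hh

theorem coeff_mem_symbPow {f : Polynomial A} (hf : f ∈ symbolicRees Q) (n : ℕ) :
    f.coeff n ∈ symbPow Q n := by
  have h0 : symbPow Q 0 = ⊤ := by
    rw [symbPow, pow_zero, Ideal.one_eq_top, Ideal.map_top, Ideal.comap_top]
  induction hf using Algebra.adjoin_induction generalizing n with
  | mem f hf =>
    obtain ⟨m, p, hp, rfl⟩ := Set.mem_iUnion.1 hf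
    rw [Polynomial.coeff_C_mul_X_pow]
    split_ifs with h
    · rwa [h]
    · exact zero_mem _
  | algebraMap r =>
    rw [Polynomial.algebraMap_apply, Polynomial.coeff_C]
    split_ifs with h
    · simp [h, h0]
    · exact zero_mem _
  | add f g _ _ hf hg => exact Polynomial.coeff_add f g n ▸ add_mem (hf n) (hg n)
  | mul f g _ _ hf hg =>
    rw [Polynomial.coeff_mul]
    refine sum_mem fun ij hij => ?_
    rw [← Finset.HasAntidiagonal.mem_antidiagonal.1 hij]
    exact mul_mem_symbPow (hf _) (hg _)

end SymbolicPowers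

section MonomialCurve

variable (K : Type*) [Field K]

theorem f₁_mem_pIdeal : f₁ (X 0) (X 1) (X 2) ∈ pIdeal K 5 11 18 := by
  rw [pIdeal, RingHom.mem_ker]
  simp [f₁, toPoly]
  ring

theorem f₂_mem_pIdeal : f₂ (X 0) (X 1) (X 2) ∈ pIdeal K 5 11 18 := by
  rw [pIdeal, RingHom.mem_ker]
  simp [f₂, toPoly]
  ring

theorem f₃_mem_pIdeal : f₃ (X 0) (X 1) (X 2) ∈ pIdeal K 5 11 18 := by
  rw [pIdeal, RingHom.mem_ker]
  simp [f₃, toPoly]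
  ring

theorem X_pow_notMem_pIdeal (m : ℕ) : (X 0 : MvPolynomial (Fin 3) K) ^ m ∉ pIdeal K 5 11 18 := by
  rw [pIdeal, RingHom.mem_ker]
  simp [toPoly]

theorem polyG₁_mem_symbPow : polyG₁ K ∈ symbPow (pIdeal K 5 11 18) 7 :=
  mem_symbPow_of_mul_mem (X_pow_notMem_pIdeal K 12)
    (pow_mul_g₁_mem (f₁_mem_pIdeal K) (f₂_mem_pIdeal K) (f₃_mem_pIdeal K))

theorem polyG₂_mem_symbPow : polyG₂ K ∈ symbPow (pIdeal K 5 11 18) 4 :=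
  mem_symbPow_of_mul_mem (X_pow_notMem_pIdeal K 6)
    (pow_mul_g₂_mem (f₁_mem_pIdeal K) (f₂_mem_pIdeal K) (f₃_mem_pIdeal K))

variable {K}

/-- A ring homomorphism out of `K[x, y, z]` that makes `x` invertible and kills `f₁` and `f₂`
factors through `K[T]`, with `T = y / x ^ 2`. -/
theorem map_eq_zero_of_mem_pIdeal {L : Type*} [CommRing L] (r : MvPolynomial (Fin 3) K →+* L)
    (hx : IsUnit (r (X 0))) (h₁ : r (f₁ (X 0) (X 1) (X 2)) = 0)
    (h₂ : r (f₂ (X 0) (X 1) (X 2)) = 0) {f : MvPolynomial (Fin 3) K}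
    (hf : f ∈ pIdeal K 5 11 18) : r f = 0 := by
  obtain ⟨v, hv⟩ := hx.exists_right_inv
  simp only [f₁, f₂, map_sub, map_mul, map_pow] at h₁ h₂
  generalize hx₀ : r (X 0) = x at *
  generalize hy : r (X 1) = y at *
  generalize hz : r (X 2) = z at *
  have h₅ : y ^ 5 = x ^ 11 := by linear_combination y ^ 2 * h₂ - x ^ 3 * h₁
  have hpow : ∀ n : ℕ, (x * v) ^ n = 1 := fun n => by rw [hv, one_pow]
  have e₀ : (y * v ^ 2) ^ 5 = x := by
    calc (y * v ^ 2) ^ 5 = y ^ 5 * v ^ 10 := by ring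
      _ = x * (x * v) ^ 10 := by rw [h₅]; ring
      _ = x := by rw [hpow, mul_one]
  have e₁ : (y * v ^ 2) ^ 11 = y := by
    calc (y * v ^ 2) ^ 11 = (y ^ 5) ^ 2 * y * v ^ 22 := by ring
      _ = y * (x * v) ^ 22 := by rw [h₅]; ring
      _ = y := by rw [hpow, mul_one]
  have e₂ : (y * v ^ 2) ^ 18 = z := by
    calc (y * v ^ 2) ^ 18 = (y ^ 5) ^ 3 * y ^ 3 * v ^ 36 := by ring
      _ = z * (x * v) ^ 36 := by rw [h₅, sub_eq_zero.1 h₂]; ring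
      _ = z := by rw [hpow, mul_one]
  have h : (Polynomial.eval₂RingHom (r.comp C) (y * v ^ 2)).comp (toPoly K 5 11 18).toRingHom =
      r := by
    refine MvPolynomial.ringHom_ext (fun c => ?_) (fun i => ?_)
    · simp [toPoly]
    · fin_cases i
      · simpa [toPoly, hx₀] using e₀
      · simpa [toPoly, hy] using e₁
      · simpa [toPoly, hz] using e₂
  have hf : toPoly K 5 11 18 f = 0 := hf
  rw [← h]
  simp [hf]

theorem exists_X_pow_mul_mem_of_mem_pIdeal {f : MvPolynomial (Fin 3) K}
    (hf : f ∈ pIdeal K 5 11 18) :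
    ∃ m, X 0 ^ m * f ∈
      Ideal.span {f₁ (X 0) (X 1) (X 2), f₂ (X 0) (X 1) (X 2)} := by
  set Q : Ideal (MvPolynomial (Fin 3) K) :=
    Ideal.span {f₁ (X 0) (X 1) (X 2), f₂ (X 0) (X 1) (X 2)}
  have hQ : ∀ g ∈ Q, algebraMap _ (Localization.Away (Ideal.Quotient.mk Q (X 0)))
      (Ideal.Quotient.mk Q g) = 0 := fun g hg => by
    rw [Ideal.Quotient.eq_zero_iff_mem.2 hg, map_zero]
  have h := map_eq_zero_of_mem_pIdeal
    ((algebraMap _ (Localization.Away (Ideal.Quotient.mk Q (X 0)))).comp (Ideal.Quotient.mk Q))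
    (IsLocalization.Away.algebraMap_isUnit (Ideal.Quotient.mk Q (X 0))) (hQ _ (Ideal.subset_span (by simp)))
    (hQ _ (Ideal.subset_span (by simp))) hf
  obtain ⟨⟨_, m, rfl⟩, e⟩ := (IsLocalization.map_eq_zero_iff
    (Submonoid.powers (Ideal.Quotient.mk Q (X 0))) _ _).1 h
  refine ⟨m, Ideal.Quotient.eq_zero_iff_mem.1 ?_⟩
  rw [map_mul, map_pow]
  exact e

theorem exists_X_pow_mul_mem_weightedPow {n : ℕ} {h : MvPolynomial (Fin 3) K}
    (hh : h ∈ pIdeal K 5 11 18 ^ n) :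
    ∃ m, X 0 ^ m * h ∈ weightedPow (polyG₁ K) (polyG₂ K) (n - 17) := by
  let φ := algebraMap (MvPolynomial (Fin 3) K) (Localization.Away (X 0 : MvPolynomial (Fin 3) K))
  have hx : IsUnit (φ (X 0)) := IsLocalization.Away.algebraMap_isUnit _
  have hp : (pIdeal K 5 11 18).map φ ≤
      Ideal.span {f₁ (φ (X 0)) (φ (X 1)) (φ (X 2)), f₂ (φ (X 0)) (φ (X 1)) (φ (X 2))} := by
    rw [Ideal.map_le_iff_le_comap]
    intro f hf
    obtain ⟨m, hm⟩ := exists_X_pow_mul_mem_of_mem_pIdeal hf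
    have hm := Ideal.mem_map_of_mem φ hm
    rw [map_mul, map_pow, Ideal.unit_mul_mem_iff_mem _ (hx.pow m), Ideal.map_span,
      Set.image_pair] at hm
    simpa [f₁, f₂] using hm
  have h₁ : φ h ∈ (weightedPow (polyG₁ K) (polyG₂ K) (n - 17)).map φ := by
    rw [map_weightedPow, polyG₁, polyG₂, map_g₁, map_g₂]
    refine span_pow_le_weightedPow hx n (Ideal.pow_right_mono hp n ?_)
    rw [← Ideal.map_pow]
    exact Ideal.mem_map_of_mem φ hh
  obtain ⟨_, ⟨m, rfl⟩, hm⟩ := exists_mul_mem_of_mem_map (M := Submonoid.powers (X 0)) _ h₁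
  exact ⟨m, hm⟩

/-- Every element outside `𝔭_K(5,11,18)` divides a nonzero polynomial in `x` modulo
`𝔭_K(5,11,18)`. -/
theorem exists_aeval_sub_mul_mem {s : MvPolynomial (Fin 3) K} (hs : s ∉ pIdeal K 5 11 18) :
    ∃ q : Polynomial K, q ≠ 0 ∧ ∃ s', Polynomial.aeval (X 0) q - s * s' ∈ pIdeal K 5 11 18 := by
  let B := MvPolynomial (Fin 3) K ⧸ pIdeal K 5 11 18
  let π : MvPolynomial (Fin 3) K →+* B := Ideal.Quotient.mk _
  let : Algebra (Polynomial K) B :=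
    (π.comp (Polynomial.aeval (R := K) (X 0 : MvPolynomial (Fin 3) K)).toRingHom).toAlgebra
  have hmap : ∀ q, algebraMap (Polynomial K) B q = π (Polynomial.aeval (X 0) q) := fun _ => rfl
  have hX : IsIntegral (Polynomial K) (π (X 0)) := by
    have := isIntegral_algebraMap (R := Polynomial K) (A := B) (x := Polynomial.X)
    rwa [hmap, Polynomial.aeval_X] at this
  have key : ∀ i m, X i ^ 5 - X 0 ^ m ∈ pIdeal K 5 11 18 → IsIntegral (Polynomial K) (π (X i)) :=
    fun i m h => IsIntegral.of_pow (n := 5) (by norm_num) (by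
      rw [← map_pow, Ideal.Quotient.eq.2 h, map_pow]
      exact hX.pow m)
  have hintegral : ∀ f, IsIntegral (Polynomial K) (π f) := by
    intro f
    induction f using MvPolynomial.induction_on with
    | C c =>
      have := isIntegral_algebraMap (R := Polynomial K) (A := B) (x := Polynomial.C c)
      rwa [hmap, Polynomial.aeval_C] at this
    | add f g hf hg => exact (map_add π f g) ▸ hf.add hg
    | mul_X f i hf =>
      rw [map_mul]
      refine hf.mul ?_
      fin_cases i
      · exact hX
      · refine key 1 11 ?_
        rw [pIdeal, RingHom.mem_ker]
        simp [toPoly]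
        ring
      · refine key 2 18 ?_
        rw [pIdeal, RingHom.mem_ker]
        simp [toPoly]
        ring
  have hne : π s ≠ 0 := fun h => hs (Ideal.Quotient.eq_zero_iff_mem.1 h)
  have hbot := Ideal.comap_ne_bot_of_integral_mem hne
    (Ideal.mem_span_singleton_self (π s)) (hintegral s)
  obtain ⟨q, hq, hq0⟩ := Submodule.exists_mem_ne_zero_of_ne_bot hbot
  obtain ⟨b, hb⟩ := Ideal.mem_span_singleton.1 (Ideal.mem_comap.1 hq)
  obtain ⟨s', rfl⟩ := Ideal.Quotient.mk_surjective b
  exact ⟨q, hq0, s', Ideal.Quotient.eq.1 ((hmap q).symm.trans (hb.trans (map_mul π s s').symm))⟩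

theorem mem_weightedPow_of_mem_symbPow {n : ℕ} {h : MvPolynomial (Fin 3) K}
    (hh : h ∈ symbPow (pIdeal K 5 11 18) n) :
    h ∈ weightedPow (polyG₁ K) (polyG₂ K) (n - 17) := by
  obtain ⟨s, hs, hsh⟩ := exists_mul_mem_of_mem_symbPow hh
  obtain ⟨q, hq, s', hq'⟩ := exists_aeval_sub_mul_mem hs
  obtain ⟨w, hw⟩ := sub_dvd_pow_sub_pow (Polynomial.aeval (X 0) q)
    (Polynomial.aeval (X 0) q - s * s') n
  have hqn : Polynomial.aeval (X 0) q ^ n * h ∈ pIdeal K 5 11 18 ^ n := by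
    have e : Polynomial.aeval (X 0) q ^ n * h =
        (Polynomial.aeval (X 0) q - s * s') ^ n * h + s' * w * (s * h) := by
      linear_combination h * hw
    rw [e]
    exact add_mem (Ideal.mul_mem_right _ _ (Ideal.pow_mem_pow hq' n)) (Ideal.mul_mem_left _ _ hsh)
  obtain ⟨m, hm⟩ := exists_X_pow_mul_mem_weightedPow hqn
  refine mem_weightedPow_of_aeval_mul_mem K
    (mul_ne_zero (pow_ne_zero m Polynomial.X_ne_zero) (pow_ne_zero n hq)) _ ?_
  simpa [mul_assoc] using hm

end MonomialCurve

section Main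

variable (K : Type*) [Field K]

theorem isRegular_polyG₁_polyG₂ :
    RingTheory.Sequence.IsRegular (MvPolynomial (Fin 3) K) [polyG₁ K, polyG₂ K] := by
  rw [RingTheory.Sequence.isRegular_iff, RingTheory.Sequence.isWeaklyRegular_cons_iff,
    RingTheory.Sequence.isWeaklyRegular_singleton_iff]
  refine ⟨⟨fun f g h => mul_left_cancel₀ (polyG₁_ne_zero K) h, ?_⟩, ?_⟩
  · refine (isSMulRegular_quotient_iff_mem_of_smul_mem _ _).2 fun f hf => ?_
    obtain ⟨w, -, hw⟩ := (Submodule.mem_smul_pointwise_iff_exists _ _ _).1 hf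
    obtain ⟨u, rfl⟩ := polyG₁_dvd_of_dvd_mul K f ⟨w, hw.symm⟩
    exact Submodule.smul_mem_pointwise_smul _ _ _ trivial
  · rw [smul_eq_mul, Ideal.mul_top]
    intro h
    have hle : Ideal.ofList [polyG₁ K, polyG₂ K] ≤ RingHom.ker (eval (0 : Fin 3 → K)) := by
      refine Ideal.span_le.2 fun g hg => ?_
      have hg : g = polyG₁ K ∨ g = polyG₂ K := by simpa using hg
      rcases hg with rfl | rfl
      · simp [polyG₁, RingHom.mem_ker, g₁]
      · simp [polyG₂, RingHom.mem_ker, g₂]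
    have := hle (h ▸ Submodule.mem_top : (1 : MvPolynomial (Fin 3) K) ∈ _)
    simp at this

variable {K}

theorem isWeightedHomogeneous_monomial_of_eq {a b e n : ℕ} (h : 5 * a + 11 * b + 18 * e = n) :
    IsWeightedHomogeneous (wt 5 11 18)
      (X 0 ^ a * X 1 ^ b * X 2 ^ e : MvPolynomial (Fin 3) K) n := by
  have h' := (((isWeightedHomogeneous_X K (wt 5 11 18) 0).pow a).mul
    ((isWeightedHomogeneous_X K (wt 5 11 18) 1).pow b)).mul
    ((isWeightedHomogeneous_X K (wt 5 11 18) 2).pow e)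
  convert h' using 1
  simp [wt, ← h, mul_comm]

theorem isWeightedHomogeneous_polyG₁ : (polyG₁ K).IsWeightedHomogeneous (wt 5 11 18) 220 :=
  g₁_mem_of_forall (weightedHomogeneousSubmodule K (wt 5 11 18) 220).toAddSubgroup
    fun _ _ _ h => isWeightedHomogeneous_monomial_of_eq h

theorem isWeightedHomogeneous_polyG₂ : (polyG₂ K).IsWeightedHomogeneous (wt 5 11 18) 126 :=
  g₂_mem_of_forall (weightedHomogeneousSubmodule K (wt 5 11 18) 126).toAddSubgroup
    fun _ _ _ h => isWeightedHomogeneous_monomial_of_eq h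

theorem C_mul_X_pow_mem_symbolicRees {A : Type*} [CommRing A] {Q : Ideal A} [Q.IsPrime] {n : ℕ}
    {h : A} (hh : h ∈ symbPow Q n) : Polynomial.C h * Polynomial.X ^ n ∈ symbolicRees Q :=
  Algebra.subset_adjoin (Set.mem_iUnion.2 ⟨n, h, hh, rfl⟩)

end Main

end

end SpaceMonomial

/-- for char-`0` `K` there exist `g1 ∈ [𝔭_K(5,11,18)^{(7)}]_{220}`
and `g2 ∈ [𝔭_K(5,11,18)^{(4)}]_{126}` forming a regular sequence; consequently
`R_s(𝔭_K(5,11,18))` is Noetherian. -/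
theorem statement14 (K : Type*) [Field K] [CharZero K] :
    (∃ g1 g2 : MvPolynomial (Fin 3) K,
      g1 ∈ symbPow (pIdeal K 5 11 18) 7 ∧
      g1.IsWeightedHomogeneous (wt 5 11 18) 220 ∧
      g2 ∈ symbPow (pIdeal K 5 11 18) 4 ∧
      g2.IsWeightedHomogeneous (wt 5 11 18) 126 ∧
      RingTheory.Sequence.IsRegular (MvPolynomial (Fin 3) K) [g1, g2]) ∧
    IsNoetherianRing (symbolicRees (pIdeal K 5 11 18)) := by
  open SpaceMonomial in
  exact ⟨⟨polyG₁ K, polyG₂ K, polyG₁_mem_symbPow K, isWeightedHomogeneous_polyG₁,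
    polyG₂_mem_symbPow K, isWeightedHomogeneous_polyG₂, isRegular_polyG₁_polyG₂ K⟩,
    isNoetherianRing_of_coeff_mem_weightedPow 17 _
      (C_mul_X_pow_mem_symbolicRees (polyG₁_mem_symbPow K))
      (C_mul_X_pow_mem_symbolicRees (polyG₂_mem_symbPow K))
      fun _ hf n => mem_weightedPow_of_mem_symbPow (coeff_mem_symbPow hf n)⟩
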